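/- For every sequence (a_n)_{n≥1} of positive real numbers with ρ := limsup_{n→∞} a_n^{1/n} < ∞, there exists a nondecreasing sequence (b_n)_{n≥1} with b_n ≥ 1 for all n and lim_{n→∞} b_n/b_{n+1} = 1 such that for every s > 0 the series Σ_{n=1}^∞ b_n a_n s^{−n} diverges if s ≤ ρ and converges if s > ρ; moreover there exists a non-increasing sequence (λ(n))_{n≥1} with λ(n) ≥ 1 for all n and λ(n) → 1 such that b_n = Π_{k=1}^n λ(k) for all n. -/

import Mathlib

open Filter

/-- A sequence that is infinitely often below `t ^ n`, for every `t > 1`, is infinitely often below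
the partial products of some antitone sequence converging to `1`. -/
theorem exists_antitone_frequently_le_prod (c : ℕ → ℝ)
    (hc : ∀ t : ℝ, 1 < t → ∃ᶠ n in atTop, c n ≤ t ^ n) :
    ∃ lam : ℕ → ℝ, (∀ n, 1 ≤ lam n) ∧ Antitone lam ∧ Tendsto lam atTop (nhds 1) ∧
      ∃ᶠ n in atTop, c n ≤ ∏ k ∈ Finset.Icc 1 n, lam k := by
  obtain ⟨φ, hφ, hcφ⟩ := extraction_forall_of_frequently
    (fun j : ℕ => hc (1 + 1 / ((j : ℝ) + 1)) (lt_add_of_pos_right 1 (by positivity)))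
  have hex : ∀ k, ∃ j, k ≤ φ j := fun k => ⟨k, hφ.id_le k⟩
  let N : ℕ → ℕ := fun k => Nat.find (hex k)
  have hN_mono : Monotone N := fun k l hkl =>
    Nat.find_min' (hex k) (hkl.trans (Nat.find_spec (hex l)))
  have hN_le : ∀ j, N (φ j) ≤ j := fun j => Nat.find_min' (hex (φ j)) le_rfl
  have hN_top : Tendsto N atTop atTop := by
    refine tendsto_atTop_atTop_of_monotone hN_mono fun j => ⟨φ j + 1, ?_⟩
    exact (hφ.lt_iff_lt.1 (Nat.find_spec (hex (φ j + 1)))).le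
  have hanti : Antitone fun k => 1 + 1 / ((N k : ℝ) + 1) := by
    intro k l hkl
    have : (N k : ℝ) ≤ N l := by exact_mod_cast hN_mono hkl
    dsimp only
    gcongr
  refine ⟨fun k => 1 + 1 / ((N k : ℝ) + 1), fun k => le_add_of_nonneg_right (by positivity),
    hanti, ?_, ?_⟩
  · simpa using (tendsto_one_div_add_atTop_nhds_zero_nat.comp hN_top).const_add (1 : ℝ)
  · refine hφ.tendsto_atTop.frequently (Frequently.of_forall fun j => (hcφ j).trans ?_)
    have hle : ∀ k ∈ Finset.Icc 1 (φ j), 1 + 1 / ((j : ℝ) + 1) ≤ 1 + 1 / ((N k : ℝ) + 1) := by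
      intro k hk
      have : (N k : ℝ) ≤ j := by
        exact_mod_cast (hN_mono (Finset.mem_Icc.1 hk).2).trans (hN_le j)
      gcongr
    simpa using Finset.prod_le_prod (fun _ _ => by positivity) hle

/-- A positive sequence whose consecutive ratios tend to `1` does not affect the convergence of a
power series inside the disc given by the root test. -/
theorem summable_mul_div_pow_of_limsup_lt {a b : ℕ → ℝ} {s : ℝ} (ha : ∀ n, 1 ≤ n → 0 < a n)
    (hbdd : IsBoundedUnder (· ≤ ·) atTop (fun n : ℕ => a n ^ (1 / (n : ℝ))))
    (hb : ∀ n, 0 < b n) (hb_ratio : Tendsto (fun n => b (n + 1) / b n) atTop (nhds 1))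
    (hs : 0 < s) (hlt : limsup (fun n : ℕ => a n ^ (1 / (n : ℝ))) atTop < s) :
    Summable (fun n => b n * a n / s ^ n) := by
  obtain ⟨r, hr, hrs⟩ := exists_between (max_lt hlt hs)
  have hr0 : 0 < r := (le_max_right _ _).trans_lt hr
  have hroot := eventually_lt_of_limsup_lt ((le_max_left _ _).trans_lt hr) hbdd
  have hmajor : Summable (fun n => b n * r ^ n / s ^ n) := by
    refine summable_of_ratio_test_tendsto_lt_one ((div_lt_one hs).2 hrs)
      (Eventually.of_forall fun n => ?_) ?_
    · have := hb n
      positivity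
    · have h := hb_ratio.mul_const (r / s)
      rw [one_mul] at h
      refine h.congr fun n => ?_
      have h₁ := hb n
      have h₂ := hb (n + 1)
      rw [Real.norm_of_nonneg (by positivity), Real.norm_of_nonneg (by positivity)]
      field_simp
      ring
  refine hmajor.of_norm_bounded_eventually_nat ?_
  filter_upwards [hroot, eventually_ge_atTop 1] with n hn hn1
  have hbn := hb n
  have han := ha n hn1
  have hle : a n ≤ r ^ n := by
    have h := pow_le_pow_left₀ (Real.rpow_nonneg han.le _) hn.le n
    rwa [one_div, Real.rpow_inv_natCast_pow han.le (by lia)] at h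
  rw [Real.norm_of_nonneg (by positivity)]
  gcongr

/-- If `0 < ρ = limsup a_n^{1/n}` then `ρ ^ n / a n` is infinitely often below `t ^ n`, for every
`t > 1`. -/
theorem frequently_pow_div_le_pow_of_limsup_eq {a : ℕ → ℝ} {ρ : ℝ} (ha : ∀ n, 1 ≤ n → 0 < a n)
    (hρ : limsup (fun n : ℕ => a n ^ (1 / (n : ℝ))) atTop = ρ) (hρ0 : 0 < ρ) {t : ℝ}
    (ht : 1 < t) : ∃ᶠ n in atTop, ρ ^ n / a n ≤ t ^ n := by
  have hcob : IsCoboundedUnder (· ≤ ·) atTop (fun n : ℕ => a n ^ (1 / (n : ℝ))) := by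
    refine IsBoundedUnder.isCoboundedUnder_le (isBoundedUnder_of_eventually_ge (a := 0) ?_)
    filter_upwards [eventually_ge_atTop 1] with n hn using Real.rpow_nonneg (ha n hn).le _
  have ht0 : 0 < t := one_pos.trans ht
  have hfreq := frequently_lt_of_lt_limsup hcob ((div_lt_self hρ0 ht).trans_eq hρ.symm)
  refine (hfreq.and_eventually (eventually_ge_atTop 1)).mono fun n ⟨hn, hn1⟩ => ?_
  have han := ha n hn1
  have h := pow_le_pow_left₀ (by positivity) hn.le n
  rw [one_div, Real.rpow_inv_natCast_pow han.le (by lia), div_pow,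
    div_le_iff₀ (by positivity)] at h
  rwa [div_le_iff₀ han, mul_comm]

/-- Lemma 1 (Denker–Urbański): for a positive sequence `(a_n)` with
`ρ = limsup a_n^{1/n} < ∞` there is a slowly varying nondecreasing sequence `(b_n)`
making the power series `∑ b_n a_n s^{-n}` diverge exactly for `s ≤ ρ`; moreover
`b_n` is a product of a non-increasing sequence `λ(k) ≥ 1` tending to `1`. -/
theorem analytic_lemma (a : ℕ → ℝ) (ha : ∀ n, 1 ≤ n → 0 < a n) (ρ : ℝ)
    (hbdd : IsBoundedUnder (· ≤ ·) atTop (fun n : ℕ => a n ^ (1 / (n : ℝ))))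
    (hρ : limsup (fun n : ℕ => a n ^ (1 / (n : ℝ))) atTop = ρ) :
    ∃ b : ℕ → ℝ, (∀ n, 1 ≤ b n) ∧ Monotone b ∧
      Tendsto (fun n => b n / b (n + 1)) atTop (nhds 1) ∧
      (∀ s : ℝ, 0 < s →
        (s ≤ ρ → ¬ Summable (fun n => b n * a n / s ^ n)) ∧
        (ρ < s → Summable (fun n => b n * a n / s ^ n))) ∧
      ∃ lam : ℕ → ℝ, (∀ n, 1 ≤ lam n) ∧ Antitone lam ∧
        Tendsto lam atTop (nhds 1) ∧
        ∀ n, 1 ≤ n → b n = ∏ k ∈ Finset.Icc 1 n, lam k := by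
  obtain ⟨lam, hlam, hanti, hlim, hfreq⟩ : ∃ lam : ℕ → ℝ, (∀ n, 1 ≤ lam n) ∧ Antitone lam ∧
      Tendsto lam atTop (nhds 1) ∧
      (0 < ρ → ∃ᶠ n in atTop, ρ ^ n / a n ≤ ∏ k ∈ Finset.Icc 1 n, lam k) := by
    by_cases hρ0 : 0 < ρ
    · obtain ⟨lam, h₁, h₂, h₃, h₄⟩ := exists_antitone_frequently_le_prod (fun n => ρ ^ n / a n)
        fun t ht => frequently_pow_div_le_pow_of_limsup_eq ha hρ hρ0 ht
      exact ⟨lam, h₁, h₂, h₃, fun _ => h₄⟩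
    · exact ⟨fun _ => 1, fun _ => le_rfl, antitone_const, tendsto_const_nhds,
        fun h => absurd h hρ0⟩
  let b : ℕ → ℝ := fun n => ∏ k ∈ Finset.Icc 1 n, lam k
  have hb_succ : ∀ n, b (n + 1) = b n * lam (n + 1) := fun n =>
    Finset.prod_Icc_succ_top (by lia) lam
  have hb_pos : ∀ n, 0 < b n := fun n => Finset.prod_pos fun k _ => one_pos.trans_le (hlam k)
  have hb_mono : Monotone b := monotone_nat_of_le_succ fun n =>
    (le_mul_of_one_le_right (hb_pos n).le (hlam (n + 1))).trans_eq (hb_succ n).symm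
  have hb_one : ∀ n, 1 ≤ b n := fun n => by simpa [b] using hb_mono (Nat.zero_le n)
  have hb_ratio : Tendsto (fun n => b (n + 1) / b n) atTop (nhds 1) := by
    refine (hlim.comp (tendsto_add_atTop_nat 1)).congr fun n => ?_
    rw [hb_succ, mul_div_cancel_left₀ _ (hb_pos n).ne', Function.comp_apply]
  refine ⟨b, hb_one, hb_mono, by simpa using hb_ratio.inv₀ one_ne_zero, fun s hs =>
    ⟨fun hsρ hsum => ?_, fun hρs =>
      summable_mul_div_pow_of_limsup_lt ha hbdd hb_pos hb_ratio hs (hρ.trans_lt hρs)⟩,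
    lam, hlam, hanti, hlim, fun _ _ => rfl⟩
  have hsmall := hsum.tendsto_atTop_zero.eventually_lt_const one_pos
  obtain ⟨n, hn, hn1, hlt⟩ := ((hfreq (hs.trans_le hsρ)).and_eventually
    ((eventually_ge_atTop 1).and hsmall)).exists
  have hle : s ^ n ≤ ρ ^ n := pow_le_pow_left₀ hs.le hsρ n
  rw [div_le_iff₀ (ha n hn1)] at hn
  rw [div_lt_one (by positivity)] at hlt
  exact hlt.not_ge (hle.trans hn)
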